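/- Let A = (a_{j,k})_{j,k≥1} be the matrix with a_{1,1} = a_{2,2} = a_{2,3} = 1 and all other entries 0. Then: (a) the nonnegative sequence z = (0, 1/√2, 1/√2, 0, 0, …) satisfies ∑_{k=1}^∞ z_k² = 1 and ∑_{j=1}^∞ ((Az)_j)² = 2; (b) every nonnegative antitone sequence x with ∑_{k=1}^∞ x_k² ≤ 1 satisfies ∑_{j=1}^∞ ((Ax)_j)² < 2. Consequently the ℓ_2 operator norm of A is strictly greater than its supremum over nonnegative decreasing sequences of ℓ_2-norm at most 1. -/

import Mathlib

open scoped ENNReal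

/-- `(Ax)_j = ∑_k a_{j,k} x_k`, taken in `[0,∞]`.  Rows and columns are indexed by `ℕ`,
with index `i` corresponding to the paper's index `i+1`. -/
noncomputable def mulVec (A : ℕ → ℕ → ℝ) (x : ℕ → ℝ) (j : ℕ) : ℝ≥0∞ :=
  ∑' k, ENNReal.ofReal (A j k * x k)

/-- The matrix with `a_{1,1} = a_{2,2} = a_{2,3} = 1` and all other entries `0`
(0-based indexing: `a_{0,0} = a_{1,1} = a_{1,2} = 1`). -/
noncomputable def exMatrix : ℕ → ℕ → ℝ := fun j k =>
  if (j = 0 ∧ k = 0) ∨ (j = 1 ∧ (k = 1 ∨ k = 2)) then 1 else 0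

theorem mulVec_exMatrix_zero (x : ℕ → ℝ) : mulVec exMatrix x 0 = ENNReal.ofReal (x 0) := by
  rw [mulVec, tsum_eq_single 0 fun k hk => by simp [exMatrix, hk]]
  simp [exMatrix]

theorem mulVec_exMatrix_one (x : ℕ → ℝ) :
    mulVec exMatrix x 1 = ENNReal.ofReal (x 1) + ENNReal.ofReal (x 2) := by
  rw [mulVec, tsum_eq_sum (s := {1, 2}) fun k hk => by
    have : ¬(k = 1 ∨ k = 2) := by simpa using hk
    simp [exMatrix, this]]
  simp [exMatrix]

theorem mulVec_exMatrix_of_two_le (x : ℕ → ℝ) {j : ℕ} (hj : 2 ≤ j) :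
    mulVec exMatrix x j = 0 := by
  have h0 : j ≠ 0 := by omega
  have h1 : j ≠ 1 := by omega
  simp [mulVec, exMatrix, h0, h1]

theorem tsum_mulVec_exMatrix_sq {x : ℕ → ℝ} (hx : ∀ k, 0 ≤ x k) :
    ∑' j, mulVec exMatrix x j ^ 2 = ENNReal.ofReal (x 0 ^ 2 + (x 1 + x 2) ^ 2) := by
  rw [tsum_eq_sum (s := Finset.range 2) fun j hj => by
    rw [mulVec_exMatrix_of_two_le x (not_lt.mp fun h => hj (Finset.mem_range.mpr h)),
      zero_pow two_ne_zero]]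
  rw [Finset.sum_range_succ, Finset.sum_range_one, mulVec_exMatrix_zero, mulVec_exMatrix_one,
    ← ENNReal.ofReal_add (hx 1) (hx 2), ← ENNReal.ofReal_pow (hx 0),
    ← ENNReal.ofReal_pow (add_nonneg (hx 1) (hx 2)),
    ← ENNReal.ofReal_add (sq_nonneg _) (sq_nonneg _)]

/-- The `ℓ_2` counterexample of §4: the unit vector `z = (0, 1/√2, 1/√2, 0, …)` gives
`∑_j ((Az)_j)² = 2`, while every nonnegative decreasing `x` with `‖x‖_2 ≤ 1` has
`∑_j ((Ax)_j)² < 2`; hence `‖A‖_{ℓ_2,ℓ_2} > ‖A‖_{ℓ_2,ℓ_2,↓}`. -/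
theorem l2_counterexample :
    (∑' k, ENNReal.ofReal
        ((fun k => if k = 1 ∨ k = 2 then 1 / Real.sqrt 2 else 0) k) ^ 2) = 1 ∧
    (∑' j, (mulVec exMatrix
        (fun k => if k = 1 ∨ k = 2 then 1 / Real.sqrt 2 else 0) j) ^ 2) = 2 ∧
    (∀ x : ℕ → ℝ, (∀ k, 0 ≤ x k) → Antitone x →
      (∑' k, ENNReal.ofReal (x k) ^ 2) ≤ 1 →
      (∑' j, (mulVec exMatrix x j) ^ 2) < 2) := by
  have hsqrt : (1 / Real.sqrt 2) ^ 2 = 1 / 2 := by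
    rw [div_pow, Real.sq_sqrt zero_le_two, one_pow]
  refine ⟨?_, ?_, fun x hx hanti hsum => ?_⟩
  · rw [tsum_eq_sum (s := {1, 2}) fun k hk => by
      have : ¬(k = 1 ∨ k = 2) := by simpa using hk
      simp [this]]
    rw [Finset.sum_pair (by norm_num)]
    simp only [true_or, or_true, if_true]
    rw [← ENNReal.ofReal_pow (by positivity), hsqrt,
      ← ENNReal.ofReal_add (by norm_num) (by norm_num)]
    norm_num
  · rw [tsum_mulVec_exMatrix_sq fun k => by positivity]
    norm_num only [true_or, or_true, if_true, if_false, or_self]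
    rw [← two_mul, mul_pow, hsqrt]
    norm_num
  · rw [tsum_mulVec_exMatrix_sq hx]
    have hle : x 0 ^ 2 + x 1 ^ 2 + x 2 ^ 2 ≤ 1 := by
      have h := (ENNReal.sum_le_tsum (Finset.range 3)).trans hsum
      simp_rw [← ENNReal.ofReal_pow (hx _)] at h
      rw [← ENNReal.ofReal_sum_of_nonneg fun k _ => sq_nonneg _, ENNReal.ofReal_le_one] at h
      simpa [Finset.sum_range_succ] using h
    have h10 : x 1 ^ 2 ≤ x 0 ^ 2 := pow_le_pow_left₀ (hx 1) (hanti zero_le_one) 2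
    have h20 : x 2 ^ 2 ≤ x 0 ^ 2 := pow_le_pow_left₀ (hx 2) (hanti zero_le_two) 2
    rw [← ENNReal.ofReal_ofNat 2, ENNReal.ofReal_lt_ofReal_iff zero_lt_two]
    nlinarith [sq_nonneg (x 1 - x 2)]
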